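/- Let W ∈ ℝ^{n×n} be symmetric positive definite, let S = [s_1 ⋯ s_m] ∈ ℝ^{n×m} have linearly independent columns, let Y = [y_1 ⋯ y_m] ∈ ℝ^{n×m} satisfy s_i^T y_i > 0 for all i ∈ {1,…,m}, and let (s_0, y_0) ∈ ℝⁿ × ℝⁿ satisfy s_0^T y_0 > 0 and s_0 = S τ for some τ ∈ ℝ^m. Then there exist vectors ỹ_1, …, ỹ_m ∈ ℝⁿ such that s_i^T ỹ_i = s_i^T y_i > 0 for all i ∈ {1,…,m} and BFGS(W, (s_0, s_1, …, s_m), (y_0, y_1, …, y_m)) = BFGS(W, (s_1, …, s_m), (ỹ_1, …, ỹ_m)); that is, the full-memory BFGS matrix built from all m+1 pairs is exactly reproduced by m pairs in which the pair (s_0, y_0) is discarded and the gradient displacements are replaced by aggregated vectors ỹ_1, …, ỹ_m. -/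

import Mathlib

open Matrix

/-- One BFGS update of the matrix `W` with the curvature pair `(s, y)`:
`W ← (I − ρ y sᵀ)ᵀ W (I − ρ y sᵀ) + ρ s sᵀ` with `ρ = 1/(sᵀy)`. -/
noncomputable def bfgsUpdate {n : ℕ} (W : Matrix (Fin n) (Fin n) ℝ)
    (s y : Fin n → ℝ) : Matrix (Fin n) (Fin n) ℝ :=
  let ρ : ℝ := 1 / (s ⬝ᵥ y)
  let U : Matrix (Fin n) (Fin n) ℝ := 1 - ρ • Matrix.vecMulVec y s
  Uᵀ * W * U + ρ • Matrix.vecMulVec s s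

/-- The BFGS matrix obtained from the initial matrix `W` by applying, in order
`j = 0, 1, …, m−1`, the BFGS update with the pair `(S j, Y j)`. -/
noncomputable def bfgs {n : ℕ} (W : Matrix (Fin n) (Fin n) ℝ) {m : ℕ}
    (S Y : Fin m → Fin n → ℝ) : Matrix (Fin n) (Fin n) ℝ :=
  (List.finRange m).foldl (fun Wb j => bfgsUpdate Wb (S j) (Y j)) W

section BfgsUpdate

variable {n : ℕ} {W : Matrix (Fin n) (Fin n) ℝ}

theorem Matrix.IsSymm.dotProduct_mulVec_comm (hW : W.IsSymm) (x z : Fin n → ℝ) :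
    x ⬝ᵥ W *ᵥ z = z ⬝ᵥ W *ᵥ x := by
  rw [dotProduct_mulVec, ← mulVec_transpose, hW.eq, dotProduct_comm]

theorem Matrix.IsSymm.ext_quadratic {A B : Matrix (Fin n) (Fin n) ℝ} (hA : A.IsSymm)
    (hB : B.IsSymm) (h : ∀ x, x ⬝ᵥ A *ᵥ x = x ⬝ᵥ B *ᵥ x) : A = B := by
  have polar (x z : Fin n → ℝ) : x ⬝ᵥ A *ᵥ z = x ⬝ᵥ B *ᵥ z := by
    have hxz := h (x + z)
    simp only [mulVec_add, dotProduct_add, add_dotProduct] at hxz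
    linarith [h x, h z, hA.dotProduct_mulVec_comm x z, hB.dotProduct_mulVec_comm x z]
  ext i j
  simpa using polar (Pi.single i 1) (Pi.single j 1)

theorem dotProduct_bfgsUpdate_mulVec (W : Matrix (Fin n) (Fin n) ℝ) (s y x z : Fin n → ℝ) :
    x ⬝ᵥ bfgsUpdate W s y *ᵥ z =
      (x - ((s ⬝ᵥ x) / (s ⬝ᵥ y)) • y) ⬝ᵥ W *ᵥ (z - ((s ⬝ᵥ z) / (s ⬝ᵥ y)) • y) +
        (s ⬝ᵥ x) * (s ⬝ᵥ z) / (s ⬝ᵥ y) := by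
  have hU (v : Fin n → ℝ) : (1 - (1 / (s ⬝ᵥ y)) • vecMulVec y s) *ᵥ v =
      v - ((s ⬝ᵥ v) / (s ⬝ᵥ y)) • y := by
    rw [sub_mulVec, one_mulVec, smul_mulVec, vecMulVec_mulVec]
    ext i
    simp
    ring
  rw [← hU x, ← hU z]
  simp only [bfgsUpdate, add_mulVec, dotProduct_add, ← mulVec_mulVec, smul_mulVec,
    vecMulVec_mulVec]
  congr 1
  · rw [dotProduct_mulVec x, ← mulVec_transpose, transpose_transpose]
  · simp [dotProduct_comm x s]
    ring

theorem bfgsUpdate_isSymm (hW : W.IsSymm) (s y : Fin n → ℝ) : (bfgsUpdate W s y).IsSymm := by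
  simp only [bfgsUpdate, IsSymm, transpose_add, transpose_mul, transpose_transpose,
    transpose_smul, transpose_vecMulVec, hW.eq, mul_assoc]

theorem bfgsUpdate_posDef (hW : W.PosDef) {s y : Fin n → ℝ} (hsy : 0 < s ⬝ᵥ y) :
    (bfgsUpdate W s y).PosDef := by
  have hsymm : W.IsSymm := by simpa using hW.isHermitian
  refine PosDef.of_dotProduct_mulVec_pos (by simpa using bfgsUpdate_isSymm hsymm s y)
    fun x hx => ?_
  rw [star_trivial, dotProduct_bfgsUpdate_mulVec]
  by_cases hsx : s ⬝ᵥ x = 0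
  · simpa [hsx] using hW.dotProduct_mulVec_pos hx
  · have hnonneg := hW.posSemidef.dotProduct_mulVec_nonneg (x - ((s ⬝ᵥ x) / (s ⬝ᵥ y)) • y)
    rw [star_trivial] at hnonneg
    have : 0 < (s ⬝ᵥ x) * (s ⬝ᵥ x) / (s ⬝ᵥ y) :=
      div_pos (mul_self_pos.2 hsx) hsy
    linarith

/-- A symmetric matrix satisfying the secant equation `A y = s` is the BFGS update of any
symmetric matrix that agrees with it, as a quadratic form, on the orthogonal complement of `s`. -/
theorem bfgsUpdate_eq_of_secant {A : Matrix (Fin n) (Fin n) ℝ} (hW : W.IsSymm) (hA : A.IsSymm)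
    {s y : Fin n → ℝ} (hsy : s ⬝ᵥ y ≠ 0) (hAy : A *ᵥ y = s)
    (h : ∀ x, s ⬝ᵥ x = 0 → x ⬝ᵥ W *ᵥ x = x ⬝ᵥ A *ᵥ x) : bfgsUpdate W s y = A := by
  refine (bfgsUpdate_isSymm hW s y).ext_quadratic hA fun x => ?_
  rw [dotProduct_bfgsUpdate_mulVec, h _ (by simp [hsy])]
  simp only [mulVec_sub, mulVec_smul, dotProduct_sub, sub_dotProduct, dotProduct_smul,
    smul_dotProduct, smul_eq_mul, hA.dotProduct_mulVec_comm y x, hAy, dotProduct_comm x s,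
    dotProduct_comm y s]
  field_simp
  ring

theorem exists_quadratic_root {a b c : ℝ} (ha : 0 < a) (hc : c ≤ 0) :
    ∃ x : ℝ, a * x ^ 2 + b * x + c = 0 := by
  obtain ⟨x, hx⟩ := exists_quadratic_eq_zero ha.ne'
    ⟨√(discrim a b c), (Real.mul_self_sqrt
      (by unfold discrim; nlinarith [sq_nonneg b, mul_nonneg ha.le (neg_nonneg.2 hc)])).symm⟩
  exact ⟨x, by rw [pow_two]; exact hx⟩

/-- For `W` positive definite, `K = W⁻¹` has positive Gram determinant on linearly
independent vectors `s`, `r`; here `p = K s` and `q = K r`. -/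
theorem gram_pos (hW : W.PosDef) {s r p q : Fin n → ℝ} (hp : W *ᵥ p = s) (hq : W *ᵥ q = r)
    (hs : s ≠ 0) (hr : ∀ c : ℝ, r ≠ c • s) :
    0 < s ⬝ᵥ p ∧ 0 < (r ⬝ᵥ q) * (s ⬝ᵥ p) - (s ⬝ᵥ q) ^ 2 := by
  have hsymm : W.IsSymm := by simpa using hW.isHermitian
  have hsp : 0 < s ⬝ᵥ p := by
    have hp0 : p ≠ 0 := by
      rintro rfl
      exact hs (by simpa using hp.symm)
    simpa [hp, dotProduct_comm] using hW.dotProduct_mulVec_pos hp0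
  refine ⟨hsp, ?_⟩
  have hv : q - ((s ⬝ᵥ q) / (s ⬝ᵥ p)) • p ≠ 0 := fun h0 =>
    hr ((s ⬝ᵥ q) / (s ⬝ᵥ p)) (by rw [← hq, sub_eq_zero.1 h0, mulVec_smul, hp, ← sub_eq_zero.1 h0])
  have hpos := hW.dotProduct_mulVec_pos hv
  have hpr : r ⬝ᵥ p = s ⬝ᵥ q := by
    rw [← hp, ← hq, dotProduct_comm, hsymm.dotProduct_mulVec_comm, dotProduct_comm]
  simp only [star_trivial, mulVec_sub, mulVec_smul, hp, hq, dotProduct_sub, sub_dotProduct,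
    dotProduct_smul, smul_dotProduct, smul_eq_mul, dotProduct_comm q, dotProduct_comm p,
    hpr] at hpos
  have := mul_pos hpos hsp
  field_simp at this
  linarith

/-- A BFGS update along `t • s + r` followed by one along `s` can be exchanged for an update
along `s` followed by one along `r`. -/
theorem exists_bfgsUpdate_exchange (hW : W.PosDef) {s r y y₀ : Fin n → ℝ} {t : ℝ}
    (hr : ∀ c : ℝ, r ≠ c • s) (hsy : 0 < s ⬝ᵥ y) (h₀ : 0 < (t • s + r) ⬝ᵥ y₀) :
    ∃ y' y₀' : Fin n → ℝ, s ⬝ᵥ y' = s ⬝ᵥ y ∧ 0 < r ⬝ᵥ y₀' ∧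
      bfgsUpdate (bfgsUpdate W (t • s + r) y₀) s y =
        bfgsUpdate (bfgsUpdate W s y') r y₀' := by
  have hsymm : W.IsSymm := by simpa using hW.isHermitian
  have hinv {A : Matrix (Fin n) (Fin n) ℝ} (hA : A.PosDef) (v : Fin n → ℝ) :
      A *ᵥ (A⁻¹ *ᵥ v) = v := by
    rw [mulVec_mulVec, mul_nonsing_inv _ ((isUnit_iff_isUnit_det A).1 hA.isUnit), one_mulVec]
  obtain ⟨p, hp⟩ : ∃ p, W *ᵥ p = s := ⟨_, hinv hW s⟩
  obtain ⟨q, hq⟩ : ∃ q, W *ᵥ q = r := ⟨_, hinv hW r⟩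
  have hs : s ≠ 0 := by
    rintro rfl
    simp at hsy
  obtain ⟨hsp, hgram⟩ := gram_pos hW hp hq hs hr
  have hpr : r ⬝ᵥ p = s ⬝ᵥ q := by
    rw [← hp, ← hq, dotProduct_comm, hsymm.dotProduct_mulVec_comm, dotProduct_comm]
  have hWp (x : Fin n → ℝ) : p ⬝ᵥ W *ᵥ x = s ⬝ᵥ x := by
    rw [hsymm.dotProduct_mulVec_comm, hp, dotProduct_comm]
  have hWq (x : Fin n → ℝ) : q ⬝ᵥ W *ᵥ x = r ⬝ᵥ x := by
    rw [hsymm.dotProduct_mulVec_comm, hq, dotProduct_comm]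
  set A := bfgsUpdate (bfgsUpdate W (t • s + r) y₀) s y with hAdef
  have hA : A.PosDef := bfgsUpdate_posDef (bfgsUpdate_posDef hW h₀) hsy
  have hAsymm : A.IsSymm := by simpa using hA.isHermitian
  obtain ⟨y₀', hy₀'⟩ : ∃ v, A *ᵥ v = r := ⟨_, hinv hA r⟩
  have hry₀' : 0 < r ⬝ᵥ y₀' := by
    have hne : y₀' ≠ 0 := by
      rintro rfl
      exact hr 0 (by simpa using hy₀'.symm)
    simpa [hy₀', dotProduct_comm] using hA.dotProduct_mulVec_pos hne
  obtain ⟨σ, hσ⟩ : ∃ σ, σ = s ⬝ᵥ y := ⟨_, rfl⟩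
  obtain ⟨ρ, hρ⟩ : ∃ ρ, ρ = (t • s + r) ⬝ᵥ y₀ := ⟨_, rfl⟩
  obtain ⟨c, hc⟩ : ∃ c, c = -(r ⬝ᵥ y) / σ := ⟨_, rfl⟩
  obtain ⟨h, hh⟩ : ∃ h, h = c * (s ⬝ᵥ y₀) / ρ := ⟨_, rfl⟩
  have hσ0 : 0 < σ := hσ ▸ hsy
  have hρ0 : 0 < ρ := hρ ▸ h₀
  obtain ⟨b, hb⟩ := exists_quadratic_root (b := -2 * h * (s ⬝ᵥ q + t * (s ⬝ᵥ p)))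
    (c := -(h ^ 2 + c ^ 2 / ρ * (s ⬝ᵥ p))) hgram (neg_nonpos.2 (by positivity))
  obtain ⟨a, ha⟩ : ∃ a, a = -(h + b * (s ⬝ᵥ q)) / (s ⬝ᵥ p) := ⟨_, rfl⟩
  have ha' : a * (s ⬝ᵥ p) + b * (s ⬝ᵥ q) = -h := by
    rw [ha]
    field_simp
    ring
  -- `z + a p + b q` is the aggregated displacement, scaled by `1 / (s ⬝ᵥ y)`.
  obtain ⟨z, hz⟩ : ∃ z, z = (1 / σ) • y + (c / ρ) • y₀ := ⟨_, rfl⟩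
  have hsz : s ⬝ᵥ z = 1 + h := by
    rw [hz, hh]
    simp only [dotProduct_add, dotProduct_smul, smul_eq_mul, ← hσ]
    field_simp
  have hrz : r ⬝ᵥ z = -(t * h) := by
    have hρ' : ρ = t * (s ⬝ᵥ y₀) + r ⬝ᵥ y₀ := by
      rw [hρ, add_dotProduct, smul_dotProduct, smul_eq_mul]
    have hry : r ⬝ᵥ y = -(c * σ) := by
      rw [hc]
      field_simp
    have hry₀ : r ⬝ᵥ y₀ = ρ - t * (s ⬝ᵥ y₀) := by linarith
    rw [hz, hh]
    simp only [dotProduct_add, dotProduct_smul, smul_eq_mul, hry, hry₀]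
    field_simp
    ring
  have hquad : 2 * a * h - 2 * b * t * h + a ^ 2 * (s ⬝ᵥ p) + 2 * a * b * (s ⬝ᵥ q)
      + b ^ 2 * (r ⬝ᵥ q) = c ^ 2 / ρ := by
    refine mul_right_cancel₀ hsp.ne' ?_
    linear_combination hb + (a * (s ⬝ᵥ p) + b * (s ⬝ᵥ q) + h) * ha'
  have hsy' : s ⬝ᵥ (σ • (z + a • p + b • q)) = σ := by
    simp only [dotProduct_add, dotProduct_smul, smul_eq_mul, hsz]
    linear_combination σ * ha'
  refine ⟨σ • (z + a • p + b • q), y₀', hsy'.trans hσ, hry₀', ?_⟩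
  refine (bfgsUpdate_eq_of_secant (bfgsUpdate_isSymm hsymm _ _) hAsymm hry₀'.ne' hy₀'
    fun x hx => ?_).symm
  rw [hAdef, dotProduct_bfgsUpdate_mulVec, dotProduct_bfgsUpdate_mulVec,
    dotProduct_bfgsUpdate_mulVec, hsy', ← hσ, ← hρ]
  have hβ : (t • s + r) ⬝ᵥ (x - ((s ⬝ᵥ x) / σ) • y) = c * (s ⬝ᵥ x) := by
    simp only [add_dotProduct, smul_dotProduct, dotProduct_sub, dotProduct_smul, smul_eq_mul, hx,
      ← hσ, hc]
    field_simp
    ring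
  have hleft : x - ((s ⬝ᵥ x) / σ) • y - (c * (s ⬝ᵥ x) / ρ) • y₀ = x - (s ⬝ᵥ x) • z := by
    rw [hz]
    module
  have hright : x - ((s ⬝ᵥ x) / σ) • σ • (z + a • p + b • q) =
      x - (s ⬝ᵥ x) • z - (s ⬝ᵥ x) • (a • p + b • q) := by
    rw [smul_smul, div_mul_cancel₀ _ hσ0.ne']
    module
  rw [hβ, hleft, hright]
  generalize hu : x - (s ⬝ᵥ x) • z = u
  have hsu : s ⬝ᵥ u = -(s ⬝ᵥ x) * h := by
    rw [← hu, dotProduct_sub, dotProduct_smul, smul_eq_mul, hsz]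
    ring
  have hru : r ⬝ᵥ u = (s ⬝ᵥ x) * (t * h) := by
    rw [← hu, dotProduct_sub, dotProduct_smul, smul_eq_mul, hrz, hx]
    ring
  simp only [mulVec_sub, mulVec_add, mulVec_smul, dotProduct_sub, sub_dotProduct, dotProduct_add,
    add_dotProduct, dotProduct_smul, smul_dotProduct, smul_eq_mul, hWp, hWq, hp, hq,
    dotProduct_comm u,
    dotProduct_comm p, dotProduct_comm q, hsu, hru, hpr]
  linear_combination (s ⬝ᵥ x) ^ 2 * hquad

/-- An update along a multiple of `s` is forgotten after the update along `s`. -/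
theorem bfgsUpdate_bfgsUpdate_smul (hW : W.IsSymm) {s y y₀ : Fin n → ℝ} (c : ℝ)
    (hsy : s ⬝ᵥ y ≠ 0) :
    bfgsUpdate (bfgsUpdate W (c • s) y₀) s y = bfgsUpdate W s y := by
  refine (bfgsUpdate_isSymm (bfgsUpdate_isSymm hW _ _) _ _).ext_quadratic
    (bfgsUpdate_isSymm hW _ _) fun x => ?_
  rw [dotProduct_bfgsUpdate_mulVec, dotProduct_bfgsUpdate_mulVec W (c • s),
    dotProduct_bfgsUpdate_mulVec W s]
  have : (c • s) ⬝ᵥ (x - ((s ⬝ᵥ x) / (s ⬝ᵥ y)) • y) = 0 := by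
    simp only [smul_dotProduct, dotProduct_sub, dotProduct_smul, smul_eq_mul]
    field_simp
    simp
  simp [this]

theorem bfgs_succ {m : ℕ} (W : Matrix (Fin n) (Fin n) ℝ) (S Y : Fin (m + 1) → Fin n → ℝ) :
    bfgs W S Y = bfgs (bfgsUpdate W (S 0) (Y 0)) (Fin.tail S) (Fin.tail Y) := by
  simp only [bfgs, List.finRange_succ, List.foldl_cons, List.foldl_map, Fin.tail]

end BfgsUpdate

theorem agg_bfgs_aggregation (n m : ℕ)
    (W : Matrix (Fin n) (Fin n) ℝ) (hW : W.PosDef)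
    (S Y : Fin m → Fin n → ℝ)
    (hS : LinearIndependent ℝ S)
    (hpos : ∀ i : Fin m, 0 < S i ⬝ᵥ Y i)
    (s0 y0 : Fin n → ℝ) (h0 : 0 < s0 ⬝ᵥ y0)
    (τ : Fin m → ℝ) (hs0 : s0 = ∑ i : Fin m, τ i • S i) :
    ∃ Yt : Fin m → Fin n → ℝ,
      (∀ i : Fin m, S i ⬝ᵥ Yt i = S i ⬝ᵥ Y i ∧ 0 < S i ⬝ᵥ Yt i) ∧
      bfgs W (Fin.cons s0 S) (Fin.cons y0 Y) = bfgs W S Yt := by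
  induction m generalizing W s0 y0 with
  | zero =>
    subst hs0
    simp at h0
  | succ m ih =>
    have hsymm : W.IsSymm := by simpa using hW.isHermitian
    rw [Fin.sum_univ_succ] at hs0
    set r : Fin n → ℝ := ∑ i : Fin m, τ i.succ • S i.succ
    obtain ⟨hStail, hS0⟩ := linearIndependent_finSucc.1 hS
    rw [bfgs_succ, bfgs_succ, Fin.tail_cons, Fin.tail_cons, Fin.cons_zero, Fin.cons_zero]
    by_cases hr : ∃ c : ℝ, r = c • S 0
    · obtain ⟨c, hc⟩ := hr
      refine ⟨Y, fun i => ⟨rfl, hpos i⟩, ?_⟩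
      rw [bfgs_succ W, hs0, hc, ← add_smul, bfgsUpdate_bfgsUpdate_smul hsymm _ (hpos 0).ne']
    · push Not at hr
      rw [hs0] at h0
      obtain ⟨y', y0', hy', hy0', hex⟩ := exists_bfgsUpdate_exchange hW hr (hpos 0) h0
      have hsy' : 0 < S 0 ⬝ᵥ y' := hy' ▸ hpos 0
      obtain ⟨Yt, hYt, heq⟩ := ih _ (bfgsUpdate_posDef hW hsy') (Fin.tail S) (Fin.tail Y)
        hStail (fun i => hpos i.succ) r y0' hy0' (Fin.tail τ) rfl
      refine ⟨Fin.cons y' Yt, Fin.cases ⟨hy', hsy'⟩ hYt, ?_⟩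
      rw [bfgs_succ W, Fin.cons_zero, Fin.tail_cons, ← heq, bfgs_succ _ (Fin.cons _ _),
        Fin.tail_cons, Fin.tail_cons, Fin.cons_zero, Fin.cons_zero, hs0, hex]
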